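/- arXiv:2509.09672 — 2 statements merged into one kernel-verified Lean document; each statement's English description precedes it below -/
import Mathlib

section
/- Let G be a finite group acting on {1,…,d} (pixel positions), acting on ℝ^d by permuting coordinates: (g ∘ v)^q = v^{g⁻¹q}. Let {x₀¹,…,x₀ᴺ} ⊂ ℝ^d, α ∈ (0,1), σ² = 1 − α, and define for each pixel q the data-augmented optimal denoiser f̂^q(x) = Σ_{i∈[N]} Σ_{g∈G} (g ∘ x₀ⁱ)^q · softmax_{i,g}{−‖x − √α (g' ∘ x₀ʲ)‖²/(2σ²)}_{j∈[N], g'∈G}. Then f̂ is equivariant under G: for every h ∈ G and x ∈ ℝ^d, f̂^q(h ∘ x) = (h ∘ f̂(x))^q, equivalently f̂^q(h ∘ x) = f̂^{h⁻¹q}(x). -/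
/-!
STATEMENT 4: For a finite group `G` acting on pixel positions `{1,…,d}` (hence on
`ℝᵈ` by coordinate permutation `(g ∘ v)^q = v^{g⁻¹q}`), the data-augmented optimal
denoiser
`f̂^q(x) = Σ_{i,g} (g ∘ x₀ⁱ)^q · softmax_{i,g}{−‖x − √α (g' ∘ x₀ʲ)‖²/(2σ²)}`
is `G`-equivariant: `f̂^q(h ∘ x) = (h ∘ f̂(x))^q = f̂^{h⁻¹q}(x)` for all `h ∈ G`.
-/

open MeasureTheory ProbabilityTheory Real Filter
open scoped ENNReal

/-- Squared Euclidean norm `‖v‖² = ∑ q, (v q)²`. -/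
noncomputable def sqnorm {d : ℕ} (v : Fin d → ℝ) : ℝ := ∑ q, (v q) ^ 2

/-- Action of `g ∈ G` on `ℝᵈ` by permuting coordinates: `(g ∘ v)^q = v^{g⁻¹ q}`. -/
def permAct {d : ℕ} {G : Type*} [Group G] [MulAction G (Fin d)]
    (g : G) (v : Fin d → ℝ) : Fin d → ℝ := fun q => v (g⁻¹ • q)

/-- Softmax weight over data points and group elements:
`w_{i,g}(x) = softmax_{i,g}{−‖x − √α (g' ∘ x₀ʲ)‖²/(2σ²)}_{j ∈ [N], g' ∈ G}`. -/
noncomputable def augWeight {d N : ℕ} {G : Type*} [Group G] [Fintype G]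
    [MulAction G (Fin d)] (x0 : Fin N → Fin d → ℝ) (α σ : ℝ)
    (x : Fin d → ℝ) (i : Fin N) (g : G) : ℝ :=
  Real.exp (-sqnorm (x - Real.sqrt α • permAct g (x0 i)) / (2 * σ ^ 2)) /
    ∑ j, ∑ g' : G,
      Real.exp (-sqnorm (x - Real.sqrt α • permAct g' (x0 j)) / (2 * σ ^ 2))

/-- The data-augmented optimal denoiser
`f̂^q(x) = Σ_{i∈[N]} Σ_{g∈G} (g ∘ x₀ⁱ)^q · w_{i,g}(x)`. -/
noncomputable def augDenoiser {d N : ℕ} {G : Type*} [Group G] [Fintype G]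
    [MulAction G (Fin d)] (x0 : Fin N → Fin d → ℝ) (α σ : ℝ)
    (x : Fin d → ℝ) : Fin d → ℝ :=
  fun q => ∑ i, ∑ g : G, permAct g (x0 i) q * augWeight x0 α σ x i g

section PermAct

variable {d N : ℕ} {G : Type*} [Group G] [MulAction G (Fin d)]

theorem permAct_mul (g h : G) (v : Fin d → ℝ) :
    permAct (g * h) v = permAct g (permAct h v) := by
  funext q
  simp [permAct, mul_smul]

theorem permAct_sub (g : G) (v w : Fin d → ℝ) :
    permAct g (v - w) = permAct g v - permAct g w := rfl

theorem permAct_smul (g : G) (c : ℝ) (v : Fin d → ℝ) :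
    permAct g (c • v) = c • permAct g v := rfl

theorem sqnorm_permAct (g : G) (v : Fin d → ℝ) : sqnorm (permAct g v) = sqnorm v :=
  Equiv.sum_comp (MulAction.toPerm g⁻¹) fun q => v q ^ 2

theorem sqnorm_permAct_sub_smul_permAct_mul (h g : G) (c : ℝ) (x v : Fin d → ℝ) :
    sqnorm (permAct h x - c • permAct (h * g) v) = sqnorm (x - c • permAct g v) := by
  rw [permAct_mul, ← permAct_smul, ← permAct_sub, sqnorm_permAct]

variable [Fintype G]

theorem augWeight_permAct_mul (x0 : Fin N → Fin d → ℝ) (α σ : ℝ) (x : Fin d → ℝ)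
    (i : Fin N) (h g : G) :
    augWeight x0 α σ (permAct h x) i (h * g) = augWeight x0 α σ x i g := by
  unfold augWeight
  rw [sqnorm_permAct_sub_smul_permAct_mul]
  congr 1
  refine Finset.sum_congr rfl fun j _ => ?_
  rw [← Equiv.sum_comp (Equiv.mulLeft h)]
  simp only [Equiv.coe_mulLeft, sqnorm_permAct_sub_smul_permAct_mul]

theorem augDenoiser_permAct (x0 : Fin N → Fin d → ℝ) (α σ : ℝ) (h : G) (x : Fin d → ℝ) :
    augDenoiser (G := G) x0 α σ (permAct h x) =
      permAct h (augDenoiser (G := G) x0 α σ x) := by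
  funext q
  refine Finset.sum_congr rfl fun i _ => ?_
  rw [← Equiv.sum_comp (Equiv.mulLeft h)]
  simp only [Equiv.coe_mulLeft, augWeight_permAct_mul, permAct_mul]
  rfl

end PermAct

theorem augmented_denoiser_is_equivariant
    {d N : ℕ} {G : Type*} [Group G] [Fintype G] [MulAction G (Fin d)]
    (hN : 0 < N) (x0 : Fin N → Fin d → ℝ) (α σ : ℝ)
    (hα : α ∈ Set.Ioo (0 : ℝ) 1) (hσ : 0 < σ) (hσ2 : σ ^ 2 = 1 - α)
    (h : G) (x : Fin d → ℝ) :
    augDenoiser (G := G) x0 α σ (permAct h x) = permAct h (augDenoiser (G := G) x0 α σ x)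
    ∧ ∀ q : Fin d,
        augDenoiser (G := G) x0 α σ (permAct h x) q
          = augDenoiser (G := G) x0 α σ x (h⁻¹ • q) := by
  have key := augDenoiser_permAct x0 α σ h x
  exact ⟨key, congrFun key⟩
end

section
/- Let {x₀¹,…,x₀ᴺ} ⊂ ℝ^d, α ∈ (0,1), σ² = 1 − α, and let A : ℝ^d → ℝ^d be any linear map. Let P = Aᵀ(AAᵀ)†A be the orthogonal projection onto the row space of A (where † denotes Moore–Penrose pseudoinverse). Then the minimizer, over measurable g : ℝ^d → ℝ satisfying the generalized locality constraint g(x) = g(Ax) for all x (i.e., g factors through A), of the per-pixel objective E_{i ~ Unif([N]), ε ~ N(0,I)} |g(√α x₀ⁱ + σε) − (x₀ⁱ)^q|² is ĝ(x) = Σ_{i∈[N]} (x₀ⁱ)^q · softmaxᵢ{ −‖P(x − √α x₀ʲ)‖²/(2σ²) }_{j∈[N]}. In particular, the constrained optimum depends on A only through the row space of A. -/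
/-!
STATEMENT 7: For a linear map `A : ℝᵈ → ℝᵈ`, let `P = Aᵀ(AAᵀ)†A` (with `†` the
Moore–Penrose pseudoinverse, characterized by the four Penrose conditions). Then
`ĝ(x) = Σᵢ (x₀ⁱ)^q · softmaxᵢ{−‖P(x − √α x₀ʲ)‖²/(2σ²)}` minimizes, over measurable
`g : ℝᵈ → ℝ` satisfying the generalized locality constraint (`g` factors through
`A`), the per-pixel objective `E_{i ~ Unif([N]), ε ~ N(0,I)} |g(√α x₀ⁱ + σε) − (x₀ⁱ)^q|²`;
`ĝ` itself satisfies the constraint, and the constrained optimum depends on `A`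
only through the row space of `A`.
-/

open MeasureTheory ProbabilityTheory Real Filter Matrix
open scoped ENNReal

/-- Standard Gaussian `N(0, I)` on `ℝᵈ`. -/
noncomputable def stdGaussian (d : ℕ) : Measure (Fin d → ℝ) :=
  Measure.pi fun _ => gaussianReal 0 1

/-- `B` is the Moore–Penrose pseudoinverse of `M` (the four Penrose conditions,
which characterize `M†` uniquely). -/
def IsMoorePenrose {m n : ℕ} (M : Matrix (Fin m) (Fin n) ℝ)
    (B : Matrix (Fin n) (Fin m) ℝ) : Prop :=
  M * B * M = M ∧ B * M * B = B ∧ (M * B)ᵀ = M * B ∧ (B * M)ᵀ = B * M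

/-- The projected per-pixel optimal denoiser
`ĝ(x) = Σᵢ (x₀ⁱ)^q · softmaxᵢ{−‖P(x − √α x₀ʲ)‖²/(2σ²)}_{j∈[N]}`. -/
noncomputable def projDenoiser {d N : ℕ} (x0 : Fin N → Fin d → ℝ) (α σ : ℝ)
    (q : Fin d) (P : Matrix (Fin d) (Fin d) ℝ) (x : Fin d → ℝ) : ℝ :=
  ∑ i, x0 i q *
    (Real.exp (-sqnorm (P.mulVec (x - Real.sqrt α • x0 i)) / (2 * σ ^ 2)) /
      ∑ j, Real.exp (-sqnorm (P.mulVec (x - Real.sqrt α • x0 j)) / (2 * σ ^ 2)))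

/-- The per-pixel empirical risk `E_{i ~ Unif([N]), ε ~ N(0,I)} |g(√α x₀ⁱ + σε) − (x₀ⁱ)^q|²`. -/
noncomputable def pixelRisk {d N : ℕ} (x0 : Fin N → Fin d → ℝ) (α σ : ℝ)
    (q : Fin d) (g : (Fin d → ℝ) → ℝ) : ℝ≥0∞ :=
  (N : ℝ≥0∞)⁻¹ * ∑ i, ∫⁻ e, ENNReal.ofReal
    ((g (Real.sqrt α • x0 i + σ • e) - x0 i q) ^ 2) ∂(stdGaussian d)

section MoorePenrose

variable {n : ℕ} {A B : Matrix (Fin n) (Fin n) ℝ}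

theorem IsMoorePenrose.mul_rowProj (hB : IsMoorePenrose (A * Aᵀ) B) :
    A * (Aᵀ * B * A) = A := by
  have h : (A * Aᵀ * B * A - A) * (A * Aᵀ * B * A - A)ᴴ = 0 := by
    have h1 : (A * Aᵀ * B * A - A) * Aᵀ = 0 := by
      rw [Matrix.sub_mul, Matrix.mul_assoc _ A Aᵀ, hB.1, sub_self]
    have h2 : A * Aᵀ * B * A - A = (A * Aᵀ * B - 1) * A := by
      rw [Matrix.sub_mul, Matrix.one_mul]
    rw [conjTranspose_eq_transpose_of_trivial]
    conv_lhs => rw [h2, transpose_mul, ← h2, ← Matrix.mul_assoc, h1, Matrix.zero_mul]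
  have := sub_eq_zero.1 (Matrix.self_mul_conjTranspose_eq_zero.1 h)
  simpa only [Matrix.mul_assoc] using this

theorem IsMoorePenrose.transpose_rowProj (hB : IsMoorePenrose (A * Aᵀ) B) :
    (Aᵀ * B * A)ᵀ = Aᵀ * B * A := by
  have h : (Aᵀ * B * A)ᵀ * (Aᵀ * B * A) = (Aᵀ * B * A)ᵀ := by
    conv_lhs => rw [transpose_mul (Aᵀ * B) A, transpose_mul Aᵀ B, transpose_transpose,
      Matrix.mul_assoc, Matrix.mul_assoc, hB.mul_rowProj]
    simp [Matrix.mul_assoc]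
  have h' := congrArg transpose h
  rw [transpose_mul, transpose_transpose] at h'
  exact h.symm.trans h'

theorem IsMoorePenrose.rowProj_mul_self (hB : IsMoorePenrose (A * Aᵀ) B) :
    (Aᵀ * B * A) * (Aᵀ * B * A) = Aᵀ * B * A := by
  rw [Matrix.mul_assoc (Aᵀ * B) A, hB.mul_rowProj]

theorem exists_eq_mul_of_range_transpose_le {A A' : Matrix (Fin n) (Fin n) ℝ}
    (h : LinearMap.range (Matrix.toLin' Aᵀ) ≤ LinearMap.range (Matrix.toLin' A'ᵀ)) :
    ∃ Z : Matrix (Fin n) (Fin n) ℝ, A = Z * A' := by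
  have h1 : ∀ i, ∃ z : Fin n → ℝ, A'ᵀ *ᵥ z = A i := fun i => by
    obtain ⟨z, hz⟩ := h ⟨Pi.single i 1, rfl⟩
    refine ⟨z, ?_⟩
    simp only [Matrix.toLin'_apply] at hz
    rw [hz]
    ext j
    simp
  choose Z hZ using h1
  refine ⟨Matrix.of Z, ?_⟩
  ext i j
  rw [← hZ i, mulVec_transpose]
  simp [Matrix.mul_apply, vecMul, dotProduct]

theorem IsMoorePenrose.rowProj_mul_rowProj {A' B' : Matrix (Fin n) (Fin n) ℝ}
    (hB' : IsMoorePenrose (A' * A'ᵀ) B')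
    (h : LinearMap.range (Matrix.toLin' Aᵀ) ≤ LinearMap.range (Matrix.toLin' A'ᵀ)) :
    (Aᵀ * B * A) * (A'ᵀ * B' * A') = Aᵀ * B * A := by
  obtain ⟨Z, rfl⟩ := exists_eq_mul_of_range_transpose_le h
  rw [Matrix.mul_assoc ((Z * A')ᵀ * B), Matrix.mul_assoc Z A', hB'.mul_rowProj]

theorem IsMoorePenrose.rowProj_eq {A' B' : Matrix (Fin n) (Fin n) ℝ}
    (hB : IsMoorePenrose (A * Aᵀ) B) (hB' : IsMoorePenrose (A' * A'ᵀ) B')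
    (h : LinearMap.range (Matrix.toLin' Aᵀ) = LinearMap.range (Matrix.toLin' A'ᵀ)) :
    A'ᵀ * B' * A' = Aᵀ * B * A := by
  have h1 := congrArg transpose (hB'.rowProj_mul_rowProj (B := B) h.le)
  rw [transpose_mul, hB.transpose_rowProj, hB'.transpose_rowProj] at h1
  exact (hB.rowProj_mul_rowProj (B := B') h.ge).symm.trans h1

end MoorePenrose

theorem pi_withDensity_prod {ι : Type*} [Fintype ι] {X : ι → Type*}
    [∀ i, MeasurableSpace (X i)] (μ : ∀ i, Measure (X i)) [∀ i, IsProbabilityMeasure (μ i)]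
    (f : ∀ i, X i → ℝ≥0∞) (hf : ∀ i, Measurable (f i))
    [∀ i, SigmaFinite ((μ i).withDensity (f i))] :
    Measure.pi (fun i => (μ i).withDensity (f i)) =
      (Measure.pi μ).withDensity (fun x => ∏ i, f i (x i)) := by
  refine Measure.pi_eq fun s hs => ?_
  rw [withDensity_apply _ (MeasurableSet.univ_pi hs),
    ← lintegral_indicator (MeasurableSet.univ_pi hs)]
  have h1 : (Set.univ.pi s).indicator (fun x => ∏ i, f i (x i)) =
      fun x => ∏ i, (s i).indicator (f i) (x i) := by
    ext x
    by_cases hx : x ∈ Set.univ.pi s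
    · rw [Set.indicator_of_mem hx]
      exact Finset.prod_congr rfl fun i _ => (Set.indicator_of_mem (hx i trivial) _).symm
    · rw [Set.indicator_of_notMem hx]
      simp only [Set.mem_pi, Set.mem_univ, true_imp_iff, not_forall] at hx
      obtain ⟨i, hi⟩ := hx
      exact (Finset.prod_eq_zero (Finset.mem_univ i) (Set.indicator_of_notMem hi _)).symm
  have hm : ∀ i, Measurable ((s i).indicator (f i)) := fun i => (hf i).indicator (hs i)
  rw [h1, lintegral_prod_eq_prod_lintegral_of_indepFun Finset.univ
    (fun i (x : ∀ i, X i) => (s i).indicator (f i) (x i))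
    (iIndepFun_pi fun i => (hm i).aemeasurable)
    (fun i => (hm i).comp (measurable_pi_apply i))]
  refine Finset.prod_congr rfl fun i _ => ?_
  rw [withDensity_apply _ (hs i), ← lintegral_indicator (hs i),
    (measurePreserving_eval μ i).lintegral_comp (hm i)]

theorem gaussianReal_eq_withDensity_gaussianReal_zero (m : ℝ) :
    gaussianReal m 1 = (gaussianReal 0 1).withDensity
      (fun x => ENNReal.ofReal (exp (m * x - m ^ 2 / 2))) := by
  rw [gaussianReal_of_var_ne_zero _ one_ne_zero, gaussianReal_of_var_ne_zero _ one_ne_zero,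
    ← withDensity_mul _ (measurable_gaussianPDF _ _) (by fun_prop)]
  congr 1
  ext x
  rw [Pi.mul_apply, gaussianPDF, gaussianPDF, ← ENNReal.ofReal_mul (gaussianPDFReal_nonneg _ _ _),
    gaussianPDFReal, gaussianPDFReal, mul_assoc (√_)⁻¹ (rexp _), ← Real.exp_add]
  congr 3
  simp only [NNReal.coe_one]
  ring

/-- The Cameron–Martin formula for the standard Gaussian on `ℝᵈ`. -/
theorem lintegral_stdGaussian_add {d : ℕ} (a : Fin d → ℝ) {h : (Fin d → ℝ) → ℝ≥0∞}
    (hh : Measurable h) :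
    ∫⁻ e, h (e + a) ∂(_root_.stdGaussian d) =
      ∫⁻ e, ENNReal.ofReal (exp (a ⬝ᵥ e - a ⬝ᵥ a / 2)) * h e ∂(_root_.stdGaussian d) := by
  have h1 : (_root_.stdGaussian d).map (fun e => e + a) =
      (_root_.stdGaussian d).withDensity
        (fun e => ENNReal.ofReal (exp (a ⬝ᵥ e - a ⬝ᵥ a / 2))) := by
    have h2 : (_root_.stdGaussian d).map (fun e => e + a) =
        Measure.pi fun i => gaussianReal (a i) 1 := by
      have := Measure.pi_map_pi (μ := fun _ : Fin d => gaussianReal 0 1)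
        (f := fun i (x : ℝ) => x + a i) (fun i => by fun_prop)
      simp only [gaussianReal_map_add_const, zero_add] at this
      exact this
    have h3 : ∀ i, SigmaFinite ((gaussianReal 0 1).withDensity
        (fun x => ENNReal.ofReal (exp (a i * x - a i ^ 2 / 2)))) := fun i => by
      rw [← gaussianReal_eq_withDensity_gaussianReal_zero]
      infer_instance
    rw [h2]
    simp_rw [gaussianReal_eq_withDensity_gaussianReal_zero (a _)]
    rw [pi_withDensity_prod _ _ (fun i => by fun_prop)]
    refine congrArg _ (funext fun e => ?_)
    rw [← ENNReal.ofReal_prod_of_nonneg (fun i _ => (exp_pos _).le), ← Real.exp_sum]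
    simp only [dotProduct, Finset.sum_sub_distrib, Finset.sum_div, sq]
  rw [← lintegral_map hh (by fun_prop), h1,
    lintegral_withDensity_eq_lintegral_mul _ (by unfold dotProduct; fun_prop) hh]
  rfl

theorem sum_mul_sq_sub_weightedMean_le {ι : Type*} [Fintype ι] (w y : ι → ℝ)
    (hw : 0 < ∑ i, w i) (c : ℝ) :
    ∑ i, w i * ((∑ j, y j * (w j / ∑ k, w k)) - y i) ^ 2 ≤ ∑ i, w i * (c - y i) ^ 2 := by
  set m := ∑ j, y j * (w j / ∑ k, w k) with hm
  have h1 : ∑ i, w i * y i = m * ∑ k, w k := by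
    rw [hm, Finset.sum_mul]
    refine Finset.sum_congr rfl fun i _ => ?_
    field_simp
  have h2 : ∀ b : ℝ, ∑ i, w i * (b - y i) ^ 2 =
      b ^ 2 * ∑ i, w i - 2 * b * ∑ i, w i * y i + ∑ i, w i * y i ^ 2 := fun b => by
    simp only [Finset.mul_sum, ← Finset.sum_sub_distrib, ← Finset.sum_add_distrib]
    exact Finset.sum_congr rfl fun i _ => by ring
  rw [h2, h2, h1]
  nlinarith [mul_nonneg hw.le (sq_nonneg (c - m))]

section Denoiser

variable {d N : ℕ} (x0 : Fin N → Fin d → ℝ) (α σ : ℝ) (q : Fin d)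

theorem measurable_projDenoiser (P : Matrix (Fin d) (Fin d) ℝ) :
    Measurable (projDenoiser x0 α σ q P) := by
  have h : ∀ i, Measurable fun x : Fin d → ℝ =>
      Real.exp (-sqnorm (P.mulVec (x - Real.sqrt α • x0 i)) / (2 * σ ^ 2)) := fun i => by
    unfold sqnorm mulVec dotProduct
    fun_prop
  unfold projDenoiser
  fun_prop

theorem projDenoiser_mul_congr (C A : Matrix (Fin d) (Fin d) ℝ) {x y : Fin d → ℝ}
    (h : A.mulVec x = A.mulVec y) :
    projDenoiser x0 α σ q (C * A) x = projDenoiser x0 α σ q (C * A) y := by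
  simp only [projDenoiser, mulVec_sub, ← mulVec_mulVec, h]

variable {P : Matrix (Fin d) (Fin d) ℝ}

/-- At the scaled noise `σ e`, the weights of the projected denoiser are proportional to
the Cameron–Martin densities of the shifts `(√α / σ) P x₀ⁱ`. -/
theorem projDenoiser_smul (hσ : 0 < σ) (hPt : Pᵀ = P) (hPP : P * P = P) (e : Fin d → ℝ) :
    projDenoiser x0 α σ q P (σ • e) =
      ∑ i, x0 i q * (
        exp (((√α / σ) • P *ᵥ x0 i) ⬝ᵥ e
          - ((√α / σ) • P *ᵥ x0 i) ⬝ᵥ ((√α / σ) • P *ᵥ x0 i) / 2) /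
        ∑ j, exp (((√α / σ) • P *ᵥ x0 j) ⬝ᵥ e
          - ((√α / σ) • P *ᵥ x0 j) ⬝ᵥ ((√α / σ) • P *ᵥ x0 j) / 2)) := by
  have hsq : ∀ v : Fin d → ℝ, sqnorm v = v ⬝ᵥ v := fun v => by
    simp only [sqnorm, dotProduct, sq]
  have hdot : ∀ x, (P *ᵥ x) ⬝ᵥ (P *ᵥ e) = (P *ᵥ x) ⬝ᵥ e := fun x => by
    rw [dotProduct_mulVec, ← mulVec_transpose, hPt, mulVec_mulVec, hPP]
  have hw : ∀ i, exp (-sqnorm (P *ᵥ (σ • e - √α • x0 i)) / (2 * σ ^ 2)) =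
      exp (-((P *ᵥ e) ⬝ᵥ (P *ᵥ e)) / 2) *
        exp (((√α / σ) • P *ᵥ x0 i) ⬝ᵥ e
          - ((√α / σ) • P *ᵥ x0 i) ⬝ᵥ ((√α / σ) • P *ᵥ x0 i) / 2) := fun i => by
    rw [← Real.exp_add, hsq]
    congr 1
    simp only [mulVec_sub, mulVec_smul, sub_dotProduct, dotProduct_sub, smul_dotProduct,
      dotProduct_smul, smul_eq_mul]
    rw [dotProduct_comm (P *ᵥ e) (P *ᵥ x0 i), hdot (x0 i)]
    field_simp
    ring
  unfold projDenoiser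
  simp_rw [hw, ← Finset.mul_sum]
  refine Finset.sum_congr rfl fun i _ => ?_
  rw [mul_div_mul_left _ _ (exp_pos _).ne']

theorem pixelRisk_eq_lintegral (hσ : 0 < σ) {g : (Fin d → ℝ) → ℝ} (hg : Measurable g)
    (hgP : ∀ x y : Fin d → ℝ, P *ᵥ x = P *ᵥ y → g x = g y) (hPP : P * P = P) :
    pixelRisk x0 α σ q g = (N : ℝ≥0∞)⁻¹ * ∫⁻ e, ENNReal.ofReal (∑ i,
      exp (((√α / σ) • P *ᵥ x0 i) ⬝ᵥ e
        - ((√α / σ) • P *ᵥ x0 i) ⬝ᵥ ((√α / σ) • P *ᵥ x0 i) / 2) *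
      (g (σ • e) - x0 i q) ^ 2) ∂(_root_.stdGaussian d) := by
  have hm : ∀ i, Measurable fun e : Fin d → ℝ =>
      ENNReal.ofReal ((g (σ • e) - x0 i q) ^ 2) := fun i => by fun_prop
  unfold pixelRisk
  congr 1
  simp_rw [ENNReal.ofReal_sum_of_nonneg
    (fun i _ => mul_nonneg (exp_pos _).le (sq_nonneg _)), ENNReal.ofReal_mul (exp_pos _).le]
  rw [lintegral_finsetSum _ fun i _ => by unfold dotProduct; fun_prop]
  refine Finset.sum_congr rfl fun i _ => ?_
  rw [← lintegral_stdGaussian_add _ (hm i)]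
  refine lintegral_congr fun e => ?_
  rw [hgP (√α • x0 i + σ • e) (σ • (e + (√α / σ) • P *ᵥ x0 i))]
  have h : σ * (√α / σ) = √α := by field_simp
  rw [smul_add, smul_smul, h, mulVec_add, mulVec_add, mulVec_smul P (√α) (P *ᵥ x0 i),
    mulVec_mulVec, hPP, mulVec_smul P (√α) (x0 i), add_comm]

theorem pixelRisk_projDenoiser_le (hN : 0 < N) (hσ : 0 < σ) (hPt : Pᵀ = P) (hPP : P * P = P)
    {g : (Fin d → ℝ) → ℝ} (hg : Measurable g)
    (hgP : ∀ x y : Fin d → ℝ, P *ᵥ x = P *ᵥ y → g x = g y) :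
    pixelRisk x0 α σ q (projDenoiser x0 α σ q P) ≤ pixelRisk x0 α σ q g := by
  have : Nonempty (Fin N) := ⟨⟨0, hN⟩⟩
  have hP : ∀ x y : Fin d → ℝ, P *ᵥ x = P *ᵥ y →
      projDenoiser x0 α σ q P x = projDenoiser x0 α σ q P y := fun x y h => by
    simpa only [Matrix.one_mul] using projDenoiser_mul_congr x0 α σ q 1 P h
  rw [pixelRisk_eq_lintegral x0 α σ q hσ (measurable_projDenoiser x0 α σ q P) hP hPP,
    pixelRisk_eq_lintegral x0 α σ q hσ hg hgP hPP]
  refine mul_le_mul_right (lintegral_mono fun e => ENNReal.ofReal_le_ofReal ?_) _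
  rw [projDenoiser_smul x0 α σ q hσ hPt hPP]
  exact sum_mul_sq_sub_weightedMean_le (fun i => exp (((√α / σ) • P *ᵥ x0 i) ⬝ᵥ e
      - ((√α / σ) • P *ᵥ x0 i) ⬝ᵥ ((√α / σ) • P *ᵥ x0 i) / 2)) (fun i => x0 i q)
    (Finset.sum_pos (fun i _ => exp_pos _) Finset.univ_nonempty) _

end Denoiser

theorem generalized_locality_optimal_denoiser
    {d N : ℕ} (hN : 0 < N) (x0 : Fin N → Fin d → ℝ) (α σ : ℝ)
    (hα : α ∈ Set.Ioo (0 : ℝ) 1) (hσ : 0 < σ) (hσ2 : σ ^ 2 = 1 - α)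
    (q : Fin d) (A B : Matrix (Fin d) (Fin d) ℝ)
    (hB : IsMoorePenrose (A * Aᵀ) B) :
    -- `ĝ` (with `P = Aᵀ(AAᵀ)†A`) satisfies the generalized locality constraint
    (∀ x y : Fin d → ℝ, A.mulVec x = A.mulVec y →
        projDenoiser x0 α σ q (Aᵀ * B * A) x = projDenoiser x0 α σ q (Aᵀ * B * A) y)
    -- and it minimizes the per-pixel risk over all constrained measurable `g`
    ∧ (∀ g : (Fin d → ℝ) → ℝ, Measurable g →
        (∀ x y : Fin d → ℝ, A.mulVec x = A.mulVec y → g x = g y) →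
        pixelRisk x0 α σ q (projDenoiser x0 α σ q (Aᵀ * B * A))
          ≤ pixelRisk x0 α σ q g)
    -- in particular, the constrained optimum depends on `A` only through the
    -- row space of `A` (the range of `Aᵀ`)
    ∧ (∀ A' B' : Matrix (Fin d) (Fin d) ℝ, IsMoorePenrose (A' * A'ᵀ) B' →
        LinearMap.range (Matrix.toLin' Aᵀ) = LinearMap.range (Matrix.toLin' A'ᵀ) →
        projDenoiser x0 α σ q (A'ᵀ * B' * A') = projDenoiser x0 α σ q (Aᵀ * B * A)) := by
  refine ⟨fun x y h => projDenoiser_mul_congr x0 α σ q (Aᵀ * B) A h, fun g hg hgA => ?_,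
    fun A' B' hB' h => by rw [hB.rowProj_eq hB' h]⟩
  refine pixelRisk_projDenoiser_le x0 α σ q hN hσ hB.transpose_rowProj hB.rowProj_mul_self hg
    fun x y h => hgA x y ?_
  rw [← hB.mul_rowProj, ← mulVec_mulVec x A, ← mulVec_mulVec y A, h]
end
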